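/- There exists a positive integer n₀ such that for every integer n ≥ n₀, setting q = 2^n, and for all A, B, C, D, E ∈ 𝔽_{q²} such that A D^q + C = 0, A^{q+1} + C^{q+1} + D^{q+1} + 1 = 0, and (A B^q + B)(A E^q + E) ≠ 0: if the Dillon hexanomial f_{A,B,C,D,E} is APN, then D^{q+1} = 1, A^{q+1} ≠ 1, B E^q = B^q E, and A E^q + E = D·s·(A^q E + E^q), where s is the unique element of 𝔽_{q²} with s² = D (equivalently, (A E^q + E)^{1-q} = D·s). -/

import Mathlib

/-- A function `f : F → F` is almost perfect nonlinear (APN) if for every nonzero `a`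
and every `b`, the equation `f (x + a) + f x = b` has at most two solutions. -/
def IsAPN {F : Type*} [Field F] (f : F → F) : Prop :=
  ∀ a b : F, a ≠ 0 → Set.ncard {x : F | f (x + a) + f x = b} ≤ 2

/-- The Dillon hexanomial `f_{A,B,C,D,E}(x) = A x³ + B x^{q+1} + C x^{2q+1} + D x^{q+2}
+ E x^{2q+2} + x^{3q}`. -/
def dillon {F : Type*} [Field F] (q : ℕ) (A B C D E : F) : F → F :=
  fun x => A * x ^ 3 + B * x ^ (q + 1) + C * x ^ (2 * q + 1) +
    D * x ^ (q + 2) + E * x ^ (2 * q + 2) + x ^ (3 * q)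

/-- Condition (C1): `A ≠ 0`, `C = D = 0`, `A^q B = B^q`, `A^q E = E^q`. -/
def CondC1 {F : Type*} [Field F] (q : ℕ) (A B C D E : F) : Prop :=
  A ≠ 0 ∧ C = 0 ∧ D = 0 ∧ A ^ q * B = B ^ q ∧ A ^ q * E = E ^ q

/-- Condition (C2): `A ≠ 0`, `C ≠ 0`, `D ≠ 0`, `A^{q+1} = 1`, `D = A C^q`,
`B^q = A^q B`, `E^q = A^q E`. -/
def CondC2 {F : Type*} [Field F] (q : ℕ) (A B C D E : F) : Prop :=
  A ≠ 0 ∧ C ≠ 0 ∧ D ≠ 0 ∧ A ^ (q + 1) = 1 ∧ D = A * C ^ q ∧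
    B ^ q = A ^ q * B ∧ E ^ q = A ^ q * E

/-- The key quantity `h₁` from the paper. -/
def h1Poly {F : Type*} [Field F] (q : ℕ) (A B C D : F) : F :=
  A ^ (q + 1) * B ^ (q + 1) + A * B ^ (2 * q) + A ^ q * B ^ 2 +
    B ^ 2 * C ^ q * D ^ q + B ^ (q + 1) * C ^ (q + 1) +
    B ^ (q + 1) * D ^ (q + 1) + B ^ (q + 1) + B ^ (2 * q) * C * D

/-- Over a perfect field of characteristic two with more than two elements, let `S` be a form,
linear in its second argument and square-semilinear in its first, whose diagonal (a binary cubic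
form) has no nontrivial zero. Then its polarisation takes every value on the pairs of vectors with
a prescribed nonzero value of an alternating form `M ≠ 0`. -/
theorem exists_alternating_eq_and_polar_eq {K V : Type*} [Field K] [CharP K 2] [AddCommGroup V]
    [Module K V] (hsq : ∀ c : K, ∃ k, k ^ 2 = c) (hK : ∃ k : K, k ≠ 0 ∧ k ≠ 1)
    (S M : V → V → K)
    (S_add_left : ∀ a b x, S (a + b) x = S a x + S b x)
    (S_add_right : ∀ a x y, S a (x + y) = S a x + S a y)
    (S_smul_left : ∀ (k : K) a x, S (k • a) x = k ^ 2 * S a x)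
    (S_smul_right : ∀ (k : K) a x, S a (k • x) = k * S a x)
    (S_self : ∀ a, a ≠ 0 → S a a ≠ 0)
    (M_add_left : ∀ a b x, M (a + b) x = M a x + M b x)
    (M_add_right : ∀ a x y, M a (x + y) = M a x + M a y)
    (M_smul_left : ∀ (k : K) a x, M (k • a) x = k * M a x)
    (M_smul_right : ∀ (k : K) a x, M a (k • x) = k * M a x)
    (M_self : ∀ a, M a a = 0) (hM : ∃ a x, M a x ≠ 0)
    {m : K} (hm : m ≠ 0) (b : K) :
    ∃ a x, M a x = m ∧ S a x + S x a = b := by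
  have two : (2 : K) = 0 := CharTwo.two_eq_zero
  have M_zero : ∀ x, M 0 x = 0 := fun x => by simpa using M_smul_left 0 0 x
  have M_zero' : ∀ x, M x 0 = 0 := fun x => by simpa using M_smul_right 0 x 0
  have ne_zero : ∀ a x, M a x = m → a ≠ 0 ∧ x ≠ 0 := by
    intro a x h
    constructor
    · rintro rfl
      exact hm (by rw [← h, M_zero])
    · rintro rfl
      exact hm (by rw [← h, M_zero'])
  obtain ⟨a, x, hMm, hS⟩ : ∃ a x, M a x = m ∧ S a x = 0 := by
    obtain ⟨a, x, h⟩ := hM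
    have ha : a ≠ 0 := by
      rintro rfl
      exact h (M_zero x)
    have h0 := S_self a ha
    refine ⟨a, (m / M a x) • x + (S a ((m / M a x) • x) / S a a) • a, ?_, ?_⟩
    · rw [M_add_right, M_smul_right, M_smul_right, M_self]
      field_simp
      ring
    · rw [S_add_right, S_smul_right _ a a, div_mul_cancel₀ _ h0]
      linear_combination S a ((m / M a x) • x) * two
  obtain ⟨ha, hx⟩ := ne_zero a x hMm
  have h0 := S_self a ha
  by_cases hb : b = 0
  · subst hb
    by_cases h2 : S x a = 0
    · exact ⟨a, x, hMm, by rw [hS, h2, add_zero]⟩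
    obtain ⟨k, hk0, hk⟩ : ∃ k : K, k ≠ 0 ∧ S x a + k ^ 2 * S a a ≠ 0 := by
      obtain ⟨k, hk0, hk1⟩ := hK
      by_cases h : S x a + k ^ 2 * S a a = 0
      · refine ⟨1, one_ne_zero, fun h' => hk1 ?_⟩
        have : (k - 1) ^ 2 * S a a = 0 := by
          linear_combination h + h' - (S x a + k * S a a) * two
        rw [mul_eq_zero, or_iff_left h0] at this
        exact sub_eq_zero.1 (pow_eq_zero_iff two_ne_zero |>.1 this)
      · exact ⟨k, hk0, h⟩
    have h1 : k * S a a ≠ 0 := mul_ne_zero hk0 h0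
    obtain ⟨μ, hμ⟩ := hsq ((S x a + k ^ 2 * S a a) / (k * S a a))
    have hμ0 : μ ≠ 0 := by
      rintro rfl
      exact div_ne_zero hk h1 (by rw [← hμ]; simp)
    rw [eq_div_iff h1] at hμ
    refine ⟨μ • a, μ⁻¹ • (x + k • a), ?_, ?_⟩
    · rw [M_smul_left, M_smul_right, M_add_right, M_smul_right, M_self, hMm]
      field_simp
      ring
    · simp only [S_smul_left, S_smul_right, S_add_left, S_add_right, hS]
      field_simp
      linear_combination hμ + (S x a + k ^ 2 * S a a) * two
  · suffices H : ∃ a x, M a x = m ∧ S a x = 0 ∧ S x a ≠ 0 by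
      obtain ⟨a, x, hMm, h1, h2⟩ := H
      refine ⟨(S x a / b) • a, (S x a / b)⁻¹ • x, ?_, ?_⟩
      · rw [M_smul_left, M_smul_right, hMm]
        field_simp
      · simp only [S_smul_left, S_smul_right, h1]
        field_simp
        ring
    by_cases h2 : S x a = 0
    · have h3 := S_self x hx
      have h4 : S a a + S x x ≠ 0 := by
        have hax : a + x ≠ 0 := (ne_zero (a + x) x (by rw [M_add_left, M_self, hMm, add_zero])).1
        have h := S_self _ hax
        rwa [S_add_left, S_add_right, S_add_right, hS, h2, add_zero, zero_add] at h
      refine ⟨a + x, x + (S x x / (S a a + S x x)) • (a + x), ?_, ?_, ?_⟩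
      · have hxa : M x a = -M a x := by
          have h := M_self (a + x)
          rw [M_add_left, M_add_right, M_add_right, M_self, M_self] at h
          linear_combination h
        simp only [M_add_left, M_add_right, M_smul_right, M_self, hxa, hMm]
        ring
      · simp only [S_add_left, S_add_right, S_smul_right, hS, h2]
        field_simp
        linear_combination (S x x * (S a a + S x x)) * two
      · have : S (x + (S x x / (S a a + S x x)) • (a + x)) (a + x)
            = S a a * S x x / (S a a + S x x) := by
          simp only [S_add_left, S_add_right, S_smul_left, hS, h2]
          field_simp
          linear_combination (S x x * (S a a + S x x) * S x x) * two
        rw [this]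
        exact div_ne_zero (mul_ne_zero h0 h3) h4
    · exact ⟨a, x, hMm, hS, h2⟩

/-- Hilbert's theorem 90 for an involution of a field of characteristic two. -/
theorem exists_map_eq_mul_of_mul_map_eq_one {F : Type*} [Field F] [CharP F 2] (σ : F →+* F)
    (hσ : ∀ x, σ (σ x) = x) {A : F} (hA : A * σ A = 1) : ∃ α, α ≠ 0 ∧ σ α = A * α := by
  by_cases h : 1 + σ A = 0
  · refine ⟨1, one_ne_zero, ?_⟩
    have h1 : σ A = 1 := (CharTwo.add_eq_zero.1 h).symm
    rw [h1] at hA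
    rw [map_one, hA]
  · refine ⟨1 + σ A, h, ?_⟩
    rw [map_add, map_one, hσ]
    linear_combination -hA

theorem FiniteField.exists_pow_ne_self {F : Type*} [Field F] [Fintype F] {k : ℕ} (hk : 1 < k)
    (hkF : k < Fintype.card F) : ∃ x : F, x ^ k ≠ x := by
  by_contra! h
  have hne : (Polynomial.X ^ k - Polynomial.X : Polynomial F) ≠ 0 :=
    FiniteField.X_pow_card_sub_X_ne_zero F hk
  have hcard := Polynomial.card_le_degree_of_subset_roots
    (p := (Polynomial.X ^ k - Polynomial.X : Polynomial F)) (Z := Finset.univ) (by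
      intro x _
      rw [Polynomial.mem_roots hne]
      simp [h x])
  rw [FiniteField.X_pow_card_sub_X_natDegree_eq F hk, Finset.card_univ] at hcard
  omega

theorem IsAPN.eq_zero_or_eq {F : Type*} [Field F] [Finite F] [CharP F 2] {f : F → F}
    (hf : IsAPN f) (hf0 : f 0 = 0) {a x : F} (ha : a ≠ 0) (h : f (x + a) + f x = f a) :
    x = 0 ∨ x = a := by
  by_contra! hx
  have hsub : ({0, a, x} : Set F) ⊆ {y | f (y + a) + f y = f a} := by
    rintro y (rfl | rfl | rfl)
    · simp [hf0]
    · simp [hf0, CharTwo.add_self_eq_zero]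
    · exact h
  have h3 : ({0, a, x} : Set F).ncard = 3 :=
    Set.ncard_eq_three.2 ⟨0, a, x, ha.symm, hx.1.symm, hx.2.symm, rfl⟩
  have := Set.ncard_le_ncard hsub (Set.toFinite _)
  have := hf a (f a) ha
  omega

/-- For `2 < q`, a Dillon hexanomial satisfying the three displayed conditions is never APN. -/
theorem not_isAPN_dillon {F : Type*} [Field F] [Fintype F] [CharP F 2] {q : ℕ} (hq : 2 < q)
    (hF : Fintype.card F = q ^ 2) (σ : F →+* F) (hσ : ∀ x, σ x = x ^ q) {A B C D E : F}
    (hC : A * D ^ q + C = 0)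
    (hN : A ^ (q + 1) + C ^ (q + 1) + D ^ (q + 1) + 1 = 0)
    (hBE : (A * B ^ q + B) * (A * E ^ q + E) ≠ 0) : ¬ IsAPN (dillon q A B C D E) := by
  intro hf
  have two : (2 : F) = 0 := CharTwo.two_eq_zero
  have hσσ : ∀ x, σ (σ x) = x := fun x => by
    rw [hσ, hσ, ← pow_mul, ← sq, ← hF, FiniteField.pow_card]
  have hsq : ∀ c : F, ∃ k, k ^ 2 = c := fun c =>
    (frobeniusEquiv F 2).surjective c
  have hd : ∀ x, dillon q A B C D E x = A * x ^ 3 + B * (σ x * x) + C * (σ x ^ 2 * x) +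
      D * (σ x * x ^ 2) + E * (σ x ^ 2 * x ^ 2) + σ x ^ 3 := fun x => by
    rw [hσ, dillon]
    ring
  have hd0 : dillon q A B C D E 0 = 0 := by simp [hd]
  simp only [pow_succ _ q, ← hσ] at hC hN hBE
  obtain rfl : A * σ D = C := CharTwo.add_eq_zero.1 hC
  have hq2 : q + 2 < q ^ 2 := by nlinarith
  obtain ⟨t, ht0, ht1, ht⟩ : ∃ t : F, t ≠ 0 ∧ t ≠ 1 ∧ σ t = t := by
    obtain ⟨y, hy⟩ := FiniteField.exists_pow_ne_self (F := F) (k := q + 2) (by omega) (by omega)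
    have hy' : σ y * y * y ≠ y := by
      rw [hσ]
      convert hy using 1
      ring
    refine ⟨σ y * y, fun h => ?_, fun h => hy' (by rw [h, one_mul]), ?_⟩
    · rcases mul_eq_zero.1 h with h | h
      · rw [map_eq_zero] at h
        simp [h] at hy'
      · simp [h] at hy'
    · rw [map_mul, hσσ, mul_comm]
  have hcubic : ∀ a, a ≠ 0 →
      A * a ^ 3 + D * (σ a * a ^ 2) + A * σ D * (σ a ^ 2 * a) + σ a ^ 3 ≠ 0 := by
    intro a ha h
    rcases hf.eq_zero_or_eq hd0 (x := t * a) ha (by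
      simp only [hd, map_add, map_mul, ht]
      linear_combination (2 * t ^ 3 + 3 * t ^ 2 + 3 * t) * h +
        (B * σ a * a * (t ^ 2 + t) +
          E * σ a ^ 2 * a ^ 2 * (t ^ 4 + 2 * t ^ 3 + 3 * t ^ 2 + 2 * t)) * two) with h' | h'
    · exact mul_ne_zero ht0 ha h'
    · exact ht1 (mul_right_cancel₀ ha (by rw [h', one_mul]))
  have hAD : (A * σ A + 1) * (D * σ D + 1) = 0 := by
    rw [map_mul, hσσ] at hN
    linear_combination hN
  rcases mul_eq_zero.1 hAD with hA | hD
  · obtain ⟨α, hα, hσα⟩ := exists_map_eq_mul_of_mul_map_eq_one σ hσσ (CharTwo.add_eq_zero.1 hA)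
    obtain ⟨hB, hE⟩ := mul_ne_zero_iff.1 hBE
    let K : Subfield F := σ.eqLocusField (RingHom.id F)
    have hK : ∀ k : K, σ k = k := fun k => k.2
    have _ : CharP K 2 := (RingHom.charP_iff K.subtype K.subtype.injective 2).2 inferInstance
    let S : F → F → K := fun a x =>
      ⟨σ α * a ^ 2 * x + α * D * a ^ 2 * σ x + (α * σ a ^ 2 * σ x + σ α * σ D * σ a ^ 2 * x), by
        change σ _ = _
        simp only [map_add, map_mul, map_pow, hσσ, RingHom.id_apply]
        ring⟩
    let M : F → F → K := fun a x => ⟨σ a * x + a * σ x, by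
      change σ _ = _
      simp only [map_add, map_mul, hσσ, RingHom.id_apply]
      ring⟩
    have hAα : σ A * (A * α) = α := by rw [← hσα, ← map_mul, ← hσα, hσσ]
    let m : K := ⟨(A * σ B + B) / (A * σ E + E), by
      change σ _ = _
      rw [RingHom.id_apply, ← mul_div_mul_left _ _ hα, map_div₀]
      simp only [map_add, map_mul, hσσ, hσα]
      congr 1
      · linear_combination B * hAα
      · linear_combination E * hAα⟩
    have hm : m ≠ 0 := fun h => div_ne_zero hB hE (congrArg Subtype.val h)
    have hm' : (A * σ E + E) * (m : F) = A * σ B + B := mul_div_cancel₀ _ hE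
    let b : K := ⟨α * (B * m + E * (m : F) ^ 2), by
      change σ _ = _
      simp only [map_add, map_mul, map_pow, hσα, hK, RingHom.id_apply]
      linear_combination α * (m : F) * hm' + (α * (m : F) * (A * σ B) - α * (m : F) ^ 2 * E) * two⟩
    obtain ⟨a, x, hMm, hSb⟩ := exists_alternating_eq_and_polar_eq (K := K) (V := F)
      (hsq := fun c => (frobeniusEquiv K 2).surjective c)
      (hK := ⟨⟨t, ht⟩, fun h => ht0 (congrArg Subtype.val h), fun h => ht1 (congrArg Subtype.val h)⟩)
      S M
      (S_add_left := fun a b x => Subtype.ext (by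
        simp only [S, Subfield.coe_add, map_add]
        linear_combination (a * b * (σ α * x + α * D * σ x) +
          σ a * σ b * (α * σ x + σ α * σ D * x)) * two))
      (S_add_right := fun a x y => Subtype.ext (by
        simp only [S, Subfield.coe_add, map_add]
        ring))
      (S_smul_left := fun k a x => Subtype.ext (by
        simp only [S, Subfield.coe_mul, SubmonoidClass.coe_pow, Subfield.smul_def, smul_eq_mul, map_mul, hK]
        ring))
      (S_smul_right := fun k a x => Subtype.ext (by
        simp only [S, Subfield.coe_mul, Subfield.smul_def, smul_eq_mul, map_mul, hK]
        ring))
      (S_self := fun a ha h => mul_ne_zero hα (hcubic a ha) (by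
        have h' : σ α * a ^ 2 * a + α * D * a ^ 2 * σ a +
          (α * σ a ^ 2 * σ a + σ α * σ D * σ a ^ 2 * a) = 0 := congrArg Subtype.val h
        rw [hσα] at h'
        linear_combination h'))
      (M_add_left := fun a b x => Subtype.ext (by
        simp only [M, Subfield.coe_add, map_add]
        ring))
      (M_add_right := fun a x y => Subtype.ext (by
        simp only [M, Subfield.coe_add, map_add]
        ring))
      (M_smul_left := fun k a x => Subtype.ext (by
        simp only [M, Subfield.coe_mul, Subfield.smul_def, smul_eq_mul, map_mul, hK]
        ring))
      (M_smul_right := fun k a x => Subtype.ext (by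
        simp only [M, Subfield.coe_mul, Subfield.smul_def, smul_eq_mul, map_mul, hK]
        ring))
      (M_self := fun a => Subtype.ext (by
        simp only [M, Subfield.coe_zero]
        linear_combination a * σ a * two))
      (hM := by
        obtain ⟨x, hx⟩ := FiniteField.exists_pow_ne_self (F := F) (k := q) (by omega) (by omega)
        refine ⟨1, x, fun h => hx ?_⟩
        have h' : σ 1 * x + 1 * σ x = 0 := congrArg Subtype.val h
        rw [map_one, one_mul, one_mul, hσ] at h'
        exact (CharTwo.add_eq_zero.1 h').symm)
      hm b
    have hM' : σ a * x + a * σ x = m := congrArg Subtype.val hMm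
    have hS' : (σ α * a ^ 2 * x + α * D * a ^ 2 * σ x +
          (α * σ a ^ 2 * σ x + σ α * σ D * σ a ^ 2 * x)) +
        (σ α * x ^ 2 * a + α * D * x ^ 2 * σ a + (α * σ x ^ 2 * σ a + σ α * σ D * σ x ^ 2 * a)) =
        α * (B * m + E * (m : F) ^ 2) := congrArg Subtype.val hSb
    rw [← hM', hσα] at hS'
    have ha : a ≠ 0 := by
      rintro rfl
      refine hm (Subtype.ext ?_)
      rw [← hM']
      simp
    rcases hf.eq_zero_or_eq hd0 (x := x) ha (mul_left_cancel₀ hα (by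
      simp only [hd, map_add]
      linear_combination hS' + α *
        (A * (x * a ^ 2 + x ^ 2 * a + x ^ 3) + B * (x * σ x + x * σ a + a * σ x) +
          A * σ D * (x * σ x * σ a + x * σ x ^ 2 + a * σ x * σ a) +
          D * (x * a * σ x + x * a * σ a + x ^ 2 * σ x) +
          E * (3 * x * a * σ x * σ a + x * a * σ x ^ 2 + x * a * σ a ^ 2 + x ^ 2 * σ x * σ a +
            x ^ 2 * σ x ^ 2 + x ^ 2 * σ a ^ 2 + a ^ 2 * σ x * σ a + a ^ 2 * σ x ^ 2) +
          (σ x * σ a ^ 2 + σ x ^ 2 * σ a + σ x ^ 3)) * two)) with rfl | rfl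
    · refine hm (Subtype.ext ?_)
      rw [← hM']
      simp
    · refine hm (Subtype.ext ?_)
      rw [← hM', Subfield.coe_zero]
      linear_combination x * σ x * two
  · obtain ⟨s, rfl⟩ := hsq D
    have hs : s * σ s = 1 := by
      rw [map_pow, ← mul_pow] at hD
      have : (s * σ s + 1) ^ 2 = 0 := by linear_combination hD + s * σ s * two
      exact CharTwo.add_eq_zero.1 (pow_eq_zero_iff two_ne_zero |>.1 this)
    obtain ⟨a, ha, hσa⟩ := exists_map_eq_mul_of_mul_map_eq_one σ hσσ hs
    refine hcubic a ha ?_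
    rw [hσa, map_pow]
    linear_combination A * a ^ 3 * (s * σ s + 1) * hs + (A + s ^ 3) * a ^ 3 * two

theorem statement15 :
    ∃ n₀ : ℕ, 0 < n₀ ∧ ∀ n : ℕ, n₀ ≤ n → ∀ q : ℕ, q = 2 ^ n →
      ∀ (F : Type) [Field F] [Fintype F], Fintype.card F = q ^ 2 →
        ∀ A B C D E : F,
          A * D ^ q + C = 0 →
          A ^ (q + 1) + C ^ (q + 1) + D ^ (q + 1) + 1 = 0 →
          (A * B ^ q + B) * (A * E ^ q + E) ≠ 0 →
          IsAPN (dillon q A B C D E) →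
          D ^ (q + 1) = 1 ∧ A ^ (q + 1) ≠ 1 ∧ B * E ^ q = B ^ q * E ∧
            ∀ s : F, s ^ 2 = D →
              A * E ^ q + E = D * s * (A ^ q * E + E ^ q) := by
  refine ⟨2, two_pos, ?_⟩
  rintro n hn q rfl F _ _ hF A B C D E hC hN hBE hf
  have : Fact (Nat.Prime 2) := ⟨Nat.prime_two⟩
  have : CharP F 2 := charP_of_card_eq_prime_pow (f := n * 2) (by rw [hF, pow_mul])
  have hq : 2 < 2 ^ n := lt_of_lt_of_le (by norm_num) (Nat.pow_le_pow_right two_pos hn)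
  exact (not_isAPN_dillon hq hF (iterateFrobenius F 2 n)
    (fun x => iterateFrobenius_def 2 n x) hC hN hBE hf).elim
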